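/- Let q = (q₀, q₁, q₂, q₃) ∈ ℝ⁴ with q₀² + q₁² + q₂² + q₃² = 1, and let R(q) be the associated rotation matrix, i.e. R(q) = [[q₀² + q₁² − q₂² − q₃², 2(q₁q₂ − q₀q₃), 2(q₁q₃ + q₀q₂)], [2(q₁q₂ + q₀q₃), q₀² − q₁² + q₂² − q₃², 2(q₂q₃ − q₀q₁)], [2(q₁q₃ − q₀q₂), 2(q₂q₃ + q₀q₁), q₀² − q₁² − q₂² + q₃²]]. Then the symmetric 4×4 matrix M(R(q)) equals 4·q·qᵀ, the rank-one matrix with (i,j) entry 4·q_{i−1}·q_{j−1}. -/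

import Mathlib

/-- The symmetric 4×4 matrix `M(X)` associated to a 3×3 matrix `X`. -/
def MX (X : Matrix (Fin 3) (Fin 3) ℝ) : Matrix (Fin 4) (Fin 4) ℝ :=
  !![1 + X 0 0 + X 1 1 + X 2 2, X 2 1 - X 1 2, X 0 2 - X 2 0, X 1 0 - X 0 1;
     X 2 1 - X 1 2, 1 + X 0 0 - X 1 1 - X 2 2, X 1 0 + X 0 1, X 0 2 + X 2 0;
     X 0 2 - X 2 0, X 1 0 + X 0 1, 1 - X 0 0 + X 1 1 - X 2 2, X 2 1 + X 1 2;
     X 1 0 - X 0 1, X 0 2 + X 2 0, X 2 1 + X 1 2, 1 - X 0 0 - X 1 1 + X 2 2]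

/-- The rotation matrix associated with a (unit) quaternion `q = (q₀, q₁, q₂, q₃)`. -/
def rotOfQuat (q : Fin 4 → ℝ) : Matrix (Fin 3) (Fin 3) ℝ :=
  !![q 0 ^ 2 + q 1 ^ 2 - q 2 ^ 2 - q 3 ^ 2, 2 * (q 1 * q 2 - q 0 * q 3), 2 * (q 1 * q 3 + q 0 * q 2);
     2 * (q 1 * q 2 + q 0 * q 3), q 0 ^ 2 - q 1 ^ 2 + q 2 ^ 2 - q 3 ^ 2, 2 * (q 2 * q 3 - q 0 * q 1);
     2 * (q 1 * q 3 - q 0 * q 2), 2 * (q 2 * q 3 + q 0 * q 1), q 0 ^ 2 - q 1 ^ 2 - q 2 ^ 2 + q 3 ^ 2]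

theorem MX_rotOfQuat_eq_four_smul_vecMulVec (q : Fin 4 → ℝ)
    (hq : q 0 ^ 2 + q 1 ^ 2 + q 2 ^ 2 + q 3 ^ 2 = 1) :
    MX (rotOfQuat q) = (4 : ℝ) • Matrix.vecMulVec q q := by
  ext i j
  fin_cases i <;> fin_cases j <;>
    simp [MX, rotOfQuat, Matrix.vecMulVec_apply] <;>
    linarith
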